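/- Let n ≥ 5 be odd, d ≥ 3, and let M ⊆ {1, ..., n} be a position of Z(n, d) with |M| odd and |M| ≥ 3 in which Player A is to move. Let x, y, z ∈ {0, ..., d−1} be pairwise distinct residues such that: (1) for every residue r ∈ {0,...,d−1} with r ∉ {x, y, z} and r ∉ {(d−x) mod d, (d−y) mod d, (d−z) mod d}, one has a_r even if r ∈ I_d and a_r = a_{d−r} if r ∉ I_d, and moreover a_s = a_{d−s} + 1 for every s ∈ {x, y, z} \ I_d; (2) at least one of x, y, z lies in I_d; (3) a_i ≥ 3 for every i ∈ {x, y, z} ∩ I_d. Then Player A can force a win from this position. -/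

import Mathlib

/-- `AWins d turn M` : in the crossing-out game with divisor `d`, current board
`M`, and `turn = true` iff Player A is the one to move (`false` : Player B),
Player A can force a win. Players alternately remove one number from the board
until two numbers remain; A wins iff `d` divides the sum of those two numbers. -/
def AWins (d : ℕ) (turn : Bool) (M : Finset ℕ) : Prop :=
  if M.card ≤ 2 then d ∣ M.sum id
  else if turn then ∃ a, ∃ _ : a ∈ M, AWins d false (M.erase a)
  else ∀ a, a ∈ M → AWins d true (M.erase a)
termination_by M.card
decreasing_by
  · exact Finset.card_erase_lt_of_mem ‹_›
  · exact Finset.card_erase_lt_of_mem ‹_›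

/-- `aCount d M r` : the number of elements of `M` having residue `r` modulo `d`. -/
def aCount (d : ℕ) (M : Finset ℕ) (r : ℕ) : ℕ :=
  (M.filter (fun x => x % d = r)).card

/-- `Iset d` : the set of residues modulo `d` that are their own additive
inverse modulo `d`; explicitly `{0, d/2}` if `d` is even and `{0}` if `d` is odd. -/
def Iset (d : ℕ) : Finset ℕ := if Even d then {0, d / 2} else {0}

/-- The number of elements of `M` whose class in `ZMod d` is `r`. -/
def classCount (d : ℕ) (M : Finset ℕ) (r : ZMod d) : ℕ :=
  (M.filter (fun m : ℕ => (m : ZMod d) = r)).card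

/-- A board is balanced if it can be split into pairs with sum divisible by `d`,
expressed in terms of class counts. -/
def BalancedBoard (d : ℕ) (M : Finset ℕ) : Prop :=
  ∀ r : ZMod d, classCount d M r = classCount d M (-r) ∧ (r = -r → Even (classCount d M r))

lemma classCount_erase {d : ℕ} {M : Finset ℕ} {a : ℕ} (ha : a ∈ M) (r : ZMod d) :
    classCount d M r = classCount d (M.erase a) r + if (a : ZMod d) = r then 1 else 0 := by
  unfold classCount
  rw [Finset.filter_erase]
  split_ifs with h
  · rw [Finset.card_erase_add_one]
    simp [ha, h]
  · rw [Finset.erase_eq_of_notMem (by simp [h]), add_zero]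

lemma exists_mem_of_classCount_pos {d : ℕ} {M : Finset ℕ} {r : ZMod d}
    (h : 0 < classCount d M r) : ∃ a ∈ M, (a : ZMod d) = r := by
  obtain ⟨a, ha⟩ := Finset.card_pos.mp h
  exact ⟨a, (Finset.mem_filter.mp ha).1, (Finset.mem_filter.mp ha).2⟩

lemma balanced_erase_pair_iff {d : ℕ} {M : Finset ℕ} {a b : ℕ} (ha : a ∈ M)
    (hb : b ∈ M.erase a) (hab : (b : ZMod d) = -a) :
    BalancedBoard d ((M.erase a).erase b) ↔ BalancedBoard d M := by
  unfold BalancedBoard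
  refine forall_congr' fun r => ?_
  have h1 := classCount_erase ha r
  have h2 := classCount_erase hb r
  have h3 := classCount_erase ha (-r)
  have h4 := classCount_erase hb (-r)
  rw [hab] at h2 h4
  have e1 : (-(a : ZMod d) = r) ↔ ((a : ZMod d) = -r) := neg_eq_iff_eq_neg
  have e2 : (-(a : ZMod d) = -r) ↔ ((a : ZMod d) = r) := neg_inj
  simp only [e1] at h2
  simp only [e2] at h4
  refine and_congr (by omega) (imp_congr_right fun hr => ?_)
  rw [← hr] at h2
  simp only [Nat.even_iff]
  split_ifs at h1 h2 <;> omega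

lemma BalancedBoard.exists_partner {d : ℕ} {M : Finset ℕ} (h : BalancedBoard d M) {a : ℕ} (ha : a ∈ M) :
    ∃ b ∈ M.erase a, (b : ZMod d) = -a ∧ BalancedBoard d ((M.erase a).erase b) := by
  have h1 := classCount_erase ha (a : ZMod d)
  have h2 := classCount_erase ha (-(a : ZMod d))
  rw [if_pos rfl] at h1
  obtain ⟨e, p⟩ := h a
  have hpos : 0 < classCount d (M.erase a) (-(a : ZMod d)) := by
    by_cases hs : (a : ZMod d) = -a
    · rw [← hs]
      have := Nat.even_iff.mp (p hs)
      omega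
    · rw [if_neg hs] at h2
      omega
  obtain ⟨b, hb, hba⟩ := exists_mem_of_classCount_pos hpos
  exact ⟨b, hb, hba, (balanced_erase_pair_iff ha hb hba).mpr h⟩

lemma BalancedBoard.even_card {d : ℕ} {M : Finset ℕ} (h : BalancedBoard d M) : Even M.card := by
  induction hn : M.card using Nat.strong_induction_on generalizing M with
  | _ n ih =>
    obtain rfl | ⟨a, ha⟩ := M.eq_empty_or_nonempty
    · simp [← hn]
    · obtain ⟨b, hb, -, hbal⟩ := h.exists_partner ha
      have h1 := Finset.card_erase_add_one ha
      have h2 := Finset.card_erase_add_one hb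
      have h3 := Nat.even_iff.mp (ih _ (by omega) hbal rfl)
      rw [Nat.even_iff]
      omega

lemma awins_true_of_erase {d : ℕ} {M : Finset ℕ} {a : ℕ} (hM : 3 ≤ M.card) (ha : a ∈ M)
    (h : AWins d false (M.erase a)) : AWins d true M := by
  rw [AWins, if_neg (by omega), if_pos rfl]
  exact ⟨a, ha, h⟩

lemma awins_false_of_forall {d : ℕ} {M : Finset ℕ} (hM : 4 ≤ M.card)
    (h : ∀ a ∈ M, ∃ b ∈ M.erase a, AWins d false ((M.erase a).erase b)) : AWins d false M := by
  rw [AWins, if_neg (by omega), if_neg (by simp)]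
  intro a ha
  obtain ⟨b, hb, hw⟩ := h a ha
  have := Finset.card_erase_add_one ha
  exact awins_true_of_erase (by omega) hb hw

lemma BalancedBoard.awins {d : ℕ} {M : Finset ℕ} (h : BalancedBoard d M) (hM : 2 ≤ M.card) :
    AWins d false M := by
  induction hn : M.card using Nat.strong_induction_on generalizing M with
  | _ n ih =>
    have hev := Nat.even_iff.mp h.even_card
    by_cases h2 : M.card = 2
    · rw [AWins, if_pos (by omega)]
      obtain ⟨a, ha⟩ : M.Nonempty := Finset.card_pos.mp (by omega)
      obtain ⟨b, hb, hab, -⟩ := h.exists_partner ha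
      have hb1 : M.erase a = {b} := by
        have := Finset.card_erase_add_one ha
        obtain ⟨c, hc⟩ := Finset.card_eq_one.mp (show (M.erase a).card = 1 by omega)
        rw [hc, Finset.mem_singleton] at hb
        rw [hc, hb]
      rw [← Finset.add_sum_erase _ _ ha, hb1, Finset.sum_singleton,
        ← ZMod.natCast_eq_zero_iff]
      simp [hab]
    · refine awins_false_of_forall (by omega) fun a ha => ?_
      obtain ⟨b, hb, -, hbal⟩ := h.exists_partner ha
      have h1 := Finset.card_erase_add_one ha
      have h2 := Finset.card_erase_add_one hb
      exact ⟨b, hb, ih _ (by omega) hbal (by omega) rfl⟩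

/-- Player A wins, moving second, from a balanced board enlarged by three numbers of one and
the same self-inverse class together with one arbitrary number. -/
lemma awins_of_triple {d : ℕ} {M : Finset ℕ} {p q s y : ℕ} (hp : p ∈ M) (hq : q ∈ M.erase p)
    (hs : s ∈ (M.erase p).erase q) (hy : y ∈ ((M.erase p).erase q).erase s)
    (hpq : (q : ZMod d) = -p) (hqs : (s : ZMod d) = -q) (hps : (s : ZMod d) = -p)
    (h : BalancedBoard d ((((M.erase p).erase q).erase s).erase y)) : AWins d false M := by
  induction hn : M.card using Nat.strong_induction_on generalizing M with
  | _ n ih =>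
    have c1 := Finset.card_erase_add_one hp
    have c2 := Finset.card_erase_add_one hq
    have c3 := Finset.card_erase_add_one hs
    have c4 := Finset.card_erase_add_one hy
    simp only [Finset.mem_erase] at hp hq hs hy
    have hev := Nat.even_iff.mp h.even_card
    refine awins_false_of_forall (by omega) fun a ha => ?_
    have hca := Finset.card_erase_add_one ha
    by_cases hmem : a ∈ (((M.erase p).erase q).erase s).erase y
    · obtain ⟨b, hb, -, hbal⟩ := h.exists_partner hmem
      simp only [Finset.mem_erase] at hb hmem
      have hb' : b ∈ M.erase a := by simp [hb]
      have hcb := Finset.card_erase_add_one hb'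
      refine ⟨b, hb', ih _ (by omega) ?_ ?_ ?_ ?_ ?_ rfl⟩
      iterate 4 (simp only [Finset.mem_erase]; grind)
      convert hbal using 1
      grind
    · have hcases : a = p ∨ a = q ∨ a = s ∨ a = y := by
        simp only [Finset.mem_erase] at hmem
        tauto
      have win : ∀ b ∈ M.erase a, BalancedBoard d ((M.erase a).erase b) →
          ∃ b ∈ M.erase a, AWins d false ((M.erase a).erase b) := by
        intro b hb hbal
        have hcb := Finset.card_erase_add_one hb
        exact ⟨b, hb, hbal.awins (by omega)⟩
      have remaining : ∀ b ∈ M.erase a, ∀ u ∈ (M.erase a).erase b,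
          ∀ v ∈ ((M.erase a).erase b).erase u, (v : ZMod d) = -u →
          (((M.erase a).erase b).erase u).erase v =
            (((M.erase p).erase q).erase s).erase y →
          ∃ b ∈ M.erase a, AWins d false ((M.erase a).erase b) := by
        intro b hb u hu v hv huv he
        exact win b hb ((balanced_erase_pair_iff hu hv huv).mp (he ▸ h))
      rcases hcases with rfl | rfl | rfl | rfl
      · exact remaining y (by grind) q (by grind) s (by grind) hqs (by grind)
      · exact remaining y (by grind) p (by grind) s (by grind) hps (by grind)
      · exact remaining y (by grind) p (by grind) q (by grind) hpq (by grind)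
      · exact remaining s (by grind) p (by grind) q (by grind) hpq (by grind)

/-- It suffices to check balancedness at `x`, `y`, `z` and away from them and their negatives. -/
lemma balanced_of_classes {d : ℕ} {M : Finset ℕ} {x y z : ZMod d} (hx : x = -x) (hz : z ≠ -z)
    (hrest : ∀ r, r ≠ x → r ≠ y → r ≠ z → r ≠ -y → r ≠ -z →
      classCount d M r = classCount d M (-r) ∧ (r = -r → Even (classCount d M r)))
    (hcx : Even (classCount d M x)) (hcy : classCount d M y = classCount d M (-y))
    (hcy' : y = -y → Even (classCount d M y)) (hcz : classCount d M z = classCount d M (-z)) :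
    BalancedBoard d M := by
  intro r
  by_cases h1 : r = x
  · subst h1
    exact ⟨congrArg _ hx, fun _ => hcx⟩
  by_cases h2 : r = y
  · subst h2
    exact ⟨hcy, hcy'⟩
  by_cases h3 : r = z
  · subst h3
    exact ⟨hcz, fun h => absurd h hz⟩
  by_cases h4 : r = -y
  · subst h4
    rw [neg_neg]
    exact ⟨hcy.symm, fun h => hcy ▸ hcy' h.symm⟩
  by_cases h5 : r = -z
  · subst h5
    rw [neg_neg]
    exact ⟨hcz.symm, fun h => absurd h.symm hz⟩
  exact hrest r h1 h2 h3 h4 h5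

/-- The winning criterion in terms of classes modulo `d`, with `x` self-inverse and `z` not. -/
lemma awins_of_excess_classes {d : ℕ} {M : Finset ℕ} (hcard : 3 ≤ M.card) (hodd : Odd M.card)
    {x y z : ZMod d} (hx : x = -x) (hz : z ≠ -z) (hxy : x ≠ y) (hyz : y ≠ z)
    (hrest : ∀ r, r ≠ x → r ≠ y → r ≠ z → r ≠ -y → r ≠ -z →
      classCount d M r = classCount d M (-r) ∧ (r = -r → Even (classCount d M r)))
    (hcx : 3 ≤ classCount d M x) (hcz : classCount d M z = classCount d M (-z) + 1)
    (hcy : y ≠ -y → classCount d M y = classCount d M (-y) + 1)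
    (hcy' : y = -y → 3 ≤ classCount d M y) : AWins d true M := by
  have hodd := Nat.odd_iff.mp hodd
  have hxz : x ≠ z := by grind
  have hyz' : y ≠ -z := by
    rintro rfl
    have := hcy (by grind)
    rw [neg_neg] at this
    omega
  have hnz : -z ≠ x := by grind
  obtain ⟨c, hcM, hc⟩ := exists_mem_of_classCount_pos (show 0 < classCount d M z by omega)
  have eM := classCount_erase (d := d) hcM
  simp only [hc] at eM
  have hypos : 0 < classCount d (M.erase c) y := by
    have := eM y
    rw [if_neg hyz.symm] at this
    by_cases h : y = -y
    · have := hcy' h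
      omega
    · have := hcy h
      omega
  obtain ⟨b, hbM, hb⟩ := exists_mem_of_classCount_pos hypos
  have hx1 : 3 ≤ classCount d (M.erase c) x := by
    have := eM x
    rw [if_neg hxz.symm] at this
    omega
  obtain ⟨p, hpM, hp⟩ := exists_mem_of_classCount_pos (show 0 < classCount d (M.erase c) x by omega)
  have ep := classCount_erase (d := d) hpM
  have hx2 := ep x
  rw [if_pos hp] at hx2
  obtain ⟨q, hqM, hq⟩ := exists_mem_of_classCount_pos
    (show 0 < classCount d ((M.erase c).erase p) x by omega)
  have eq := classCount_erase (d := d) hqM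
  have hx3 := eq x
  rw [if_pos hq] at hx3
  obtain ⟨s, hsM, hs⟩ := exists_mem_of_classCount_pos
    (show 0 < classCount d (((M.erase c).erase p).erase q) x by omega)
  have es := classCount_erase (d := d) hsM
  have hbM' : b ∈ (((M.erase c).erase p).erase q).erase s := by
    simp only [Finset.mem_erase] at hbM ⊢
    refine ⟨?_, ?_, ?_, hbM⟩ <;> rintro rfl <;> grind
  have eb := classCount_erase (d := d) hbM'
  have eb' := classCount_erase (d := d) hbM
  simp only [hp, hq, hs, hb] at ep eq es eb eb'
  have k1 := Finset.card_erase_add_one hcM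
  have k2 := Finset.card_erase_add_one hbM
  have k3 := Finset.card_erase_add_one hpM
  by_cases hy : y = -y ∧ Even (classCount d M y)
  · obtain ⟨hy, hye⟩ := hy
    by_cases hxe : Even (classCount d M x)
    · refine awins_true_of_erase hcard hcM (BalancedBoard.awins ?_ (by omega))
      refine balanced_of_classes (y := y) hx hz ?_ ?_ ?_ ?_ ?_ <;> grind
    · exfalso
      have hbal : BalancedBoard d ((M.erase c).erase p) := by
        refine balanced_of_classes (y := y) hx hz ?_ ?_ ?_ ?_ ?_ <;> grind
      have := Nat.even_iff.mp hbal.even_card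
      omega
  · by_cases hxe : Even (classCount d M x)
    · exfalso
      have hbal : BalancedBoard d ((M.erase c).erase b) := by
        refine balanced_of_classes (y := y) hx hz ?_ ?_ ?_ ?_ ?_ <;> grind
      have := Nat.even_iff.mp hbal.even_card
      omega
    · refine awins_true_of_erase hcard hcM (awins_of_triple hpM hqM hsM hbM' ?_ ?_ ?_ ?_)
      · rw [hq, hp, ← hx]
      · rw [hs, hq, ← hx]
      · rw [hs, hp, ← hx]
      refine balanced_of_classes (y := y) hx hz ?_ ?_ ?_ ?_ ?_ <;> grind


lemma aCount_eq_classCount {d : ℕ} (M : Finset ℕ) {r : ℕ} (hr : r < d) :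
    aCount d M r = classCount d M (r : ZMod d) := by
  unfold aCount classCount
  congr 1
  refine Finset.filter_congr fun m _ => ?_
  rw [ZMod.natCast_eq_natCast_iff', Nat.mod_eq_of_lt hr]

lemma natCast_sub_mod_eq_neg {d r : ℕ} (hr : r < d) : (((d - r) % d : ℕ) : ZMod d) = -r := by
  rw [ZMod.natCast_mod, Nat.cast_sub hr.le]
  simp

lemma mem_Iset_iff {d r : ℕ} (hr : r < d) : r ∈ Iset d ↔ (r : ZMod d) = -r := by
  rw [eq_neg_iff_add_eq_zero, ← Nat.cast_add, ZMod.natCast_eq_zero_iff]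
  have key : d ∣ r + r ↔ r + r = 0 ∨ r + r = d := by
    constructor
    · rintro ⟨k, hk⟩
      have : k < 2 := by nlinarith
      interval_cases k <;> omega
    · rintro (h | h) <;> simp [h]
  rw [key]
  unfold Iset
  split_ifs with h
  · obtain ⟨k, rfl⟩ := h
    simp only [Finset.mem_insert, Finset.mem_singleton]
    omega
  · simp only [Finset.mem_singleton]
    have : ¬ r + r = d := fun e => h ⟨r, e.symm⟩
    omega

lemma natCast_inj_of_lt {d a b : ℕ} (ha : a < d) (hb : b < d) :
    (a : ZMod d) = b ↔ a = b := by
  rw [ZMod.natCast_eq_natCast_iff', Nat.mod_eq_of_lt ha, Nat.mod_eq_of_lt hb]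

lemma aCount_sub_eq_classCount_neg {d r : ℕ} (M : Finset ℕ) (hr : r < d) (hI : r ∉ Iset d) :
    aCount d M (d - r) = classCount d M (-(r : ZMod d)) := by
  have h0 : r ≠ 0 := by
    rintro rfl
    exact hI ((mem_Iset_iff hr).mpr (by simp))
  rw [aCount_eq_classCount M (by omega), Nat.cast_sub hr.le]
  simp

theorem stmt_11 (n d : ℕ) (hn : Odd n) (h5 : 5 ≤ n) (hd : 3 ≤ d)
    (M : Finset ℕ) (hM : M ⊆ Finset.Icc 1 n)
    (hcard : 3 ≤ M.card) (hodd : Odd M.card)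
    (x y z : ℕ) (hx : x < d) (hy : y < d) (hz : z < d)
    (hxy : x ≠ y) (hyz : y ≠ z) (hxz : x ≠ z)
    (h1 : ∀ r < d, r ∉ ({x, y, z} : Finset ℕ) →
      r ∉ ({(d - x) % d, (d - y) % d, (d - z) % d} : Finset ℕ) →
      (r ∈ Iset d → Even (aCount d M r)) ∧
      (r ∉ Iset d → aCount d M r = aCount d M (d - r)))
    (h1' : ∀ s ∈ ({x, y, z} : Finset ℕ), s ∉ Iset d →
      aCount d M s = aCount d M (d - s) + 1)
    (h2 : x ∈ Iset d ∨ y ∈ Iset d ∨ z ∈ Iset d)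
    (h3 : ∀ i ∈ ({x, y, z} : Finset ℕ), i ∈ Iset d → 3 ≤ aCount d M i) :
    AWins d true M := by
  have : NeZero d := ⟨by omega⟩
  have hrest : ∀ r : ZMod d, r ≠ x → r ≠ y → r ≠ z → r ≠ -x → r ≠ -y → r ≠ -z →
      classCount d M r = classCount d M (-r) ∧ (r = -r → Even (classCount d M r)) := by
    intro r
    obtain ⟨k, hk, rfl⟩ : ∃ k < d, (k : ZMod d) = r := ⟨r.val, r.val_lt, by simp⟩
    intro a1 a2 a3 b1 b2 b3
    have hk1 : k ∉ ({x, y, z} : Finset ℕ) := by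
      simp only [Finset.mem_insert, Finset.mem_singleton]
      rintro (rfl | rfl | rfl) <;> contradiction
    have hk2 : k ∉ ({(d - x) % d, (d - y) % d, (d - z) % d} : Finset ℕ) := by
      simp only [Finset.mem_insert, Finset.mem_singleton]
      rintro (rfl | rfl | rfl)
      · exact b1 (natCast_sub_mod_eq_neg hx)
      · exact b2 (natCast_sub_mod_eq_neg hy)
      · exact b3 (natCast_sub_mod_eq_neg hz)
    obtain ⟨e1, e2⟩ := h1 k hk hk1 hk2
    rw [aCount_eq_classCount M hk, mem_Iset_iff hk] at e1
    refine ⟨?_, e1⟩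
    by_cases hs : (k : ZMod d) = -k
    · exact congrArg _ hs
    · have hI : k ∉ Iset d := mt (mem_Iset_iff hk).mp hs
      rw [← aCount_eq_classCount M hk, ← aCount_sub_eq_classCount_neg M hk hI]
      exact e2 hI
  have hexcess : ∀ s < d, s ∈ ({x, y, z} : Finset ℕ) → (s : ZMod d) ≠ -s →
      classCount d M s = classCount d M (-s) + 1 := by
    intro s hs hmem hne
    have hI : s ∉ Iset d := mt (mem_Iset_iff hs).mp hne
    rw [← aCount_eq_classCount M hs, ← aCount_sub_eq_classCount_neg M hs hI]
    exact h1' s hmem hI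
  have hself : ∀ s < d, s ∈ ({x, y, z} : Finset ℕ) → (s : ZMod d) = -s →
      3 ≤ classCount d M s := by
    intro s hs hmem he
    rw [← aCount_eq_classCount M hs]
    exact h3 s hmem ((mem_Iset_iff hs).mpr he)
  have hnot : ¬ (x ∈ Iset d ∧ y ∈ Iset d ∧ z ∈ Iset d) := by
    unfold Iset
    split_ifs <;> simp only [Finset.mem_insert, Finset.mem_singleton] <;> omega
  have cxy : (x : ZMod d) ≠ y := mt (natCast_inj_of_lt hx hy).mp hxy
  have cyz : (y : ZMod d) ≠ z := mt (natCast_inj_of_lt hy hz).mp hyz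
  have cxz : (x : ZMod d) ≠ z := mt (natCast_inj_of_lt hx hz).mp hxz
  have ex := hexcess x hx (by simp)
  have ey := hexcess y hy (by simp)
  have ez := hexcess z hz (by simp)
  have sx := hself x hx (by simp)
  have sy := hself y hy (by simp)
  have sz := hself z hz (by simp)
  simp only [mem_Iset_iff hx, mem_Iset_iff hy, mem_Iset_iff hz] at h2 hnot
  have core := @awins_of_excess_classes d M hcard hodd
  by_cases gx : (x : ZMod d) = -x
  · by_cases gz : (z : ZMod d) = -z
    · have gy : (y : ZMod d) ≠ -y := fun gy => hnot ⟨gx, gy, gz⟩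
      exact core gx gy cxz cyz.symm (fun r a b c d e => hrest r a c b (gx ▸ a) e d)
        (sx gx) (ey gy) ez sz
    · exact core gx gz cxy cyz (fun r a b c d e => hrest r a b c (gx ▸ a) d e)
        (sx gx) (ez gz) ey sy
  · by_cases gy : (y : ZMod d) = -y
    · exact core gy gx cyz cxz.symm (fun r a b c d e => hrest r c a b e (gy ▸ a) d)
        (sy gy) (ex gx) ez sz
    · have gz : (z : ZMod d) = -z := (h2.resolve_left gx).resolve_left gy
      exact core gz gx cyz.symm cxy.symm (fun r a b c d e => hrest r c b a e d (gz ▸ a))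
        (sz gz) (ex gx) ey sy
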